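/- Let R : ℝ → [1, ∞) be a continuous 2π-periodic function and let K(R) = { λ e^{−iθ} R(θ) : λ ∈ [0,1], θ ∈ [0, 2π) } ⊂ ℂ. Let (X_N) be a sequence of random complex N×N matrices such that for every θ ∈ [0, 2π), with probability one, ‖Re(e^{iθ} X_N)‖ → R(θ) as N → ∞. Then with probability one, for every ε > 0 there exists N₀ such that for all N ≥ N₀ the numerical range W(X_N) is contained in the closed ε-neighborhood of K(R) (equivalently, sup_{z ∈ W(X_N)} dist(z, K(R)) → 0). -/

import Mathlib

open MeasureTheory ProbabilityTheory Filter Metric Matrix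

noncomputable section

/-- The numerical range `W(X) = {(Xy, y) : ‖y‖₂ = 1}` of a complex `N × N` matrix. -/
def numericalRange {N : ℕ} (X : Matrix (Fin N) (Fin N) ℂ) : Set ℂ :=
  {z | ∃ y : Fin N → ℂ, ∑ i, ‖y i‖ ^ 2 = 1 ∧ z = ∑ i, (starRingEnd ℂ) (y i) * X.mulVec y i}

/-- The operator (spectral) norm of a complex matrix, acting on `ℓ²`. -/
def opNorm {N : ℕ} (X : Matrix (Fin N) (Fin N) ℂ) : ℝ :=
  ‖Matrix.toEuclideanCLM (𝕜 := ℂ) X‖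

/-- The Hermitian real part `Re A = (A + A*)/2` of a square complex matrix. -/
def reMat {N : ℕ} (X : Matrix (Fin N) (Fin N) ℂ) : Matrix (Fin N) (Fin N) ℂ :=
  (2 : ℂ)⁻¹ • (X + Xᴴ)

/-- The centered complex Gaussian measure of variance `v` on `ℂ`: real and imaginary
parts are independent centered real Gaussians of variance `v/2`. -/
def complexGaussian (v : NNReal) : Measure ℂ :=
  ((gaussianReal 0 (v / 2)).prod (gaussianReal 0 (v / 2))).map
    (fun p : ℝ × ℝ => (p.1 : ℂ) + (p.2 : ℂ) * Complex.I)


/-- The star-shaped set `K(R) = {λ e^{-iθ} R(θ) : λ ∈ [0,1], θ ∈ [0,2π)}`. -/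
def radialSet (R : ℝ → ℝ) : Set ℂ :=
  {z | ∃ l ∈ Set.Icc (0 : ℝ) 1, ∃ θ ∈ Set.Ico (0 : ℝ) (2 * Real.pi),
    z = (l : ℂ) * Complex.exp (-(θ : ℂ) * Complex.I) * (R θ : ℂ)}

theorem exists_unit_vector_of_mem_numericalRange {N : ℕ} {X : Matrix (Fin N) (Fin N) ℂ} {z : ℂ}
    (hz : z ∈ numericalRange X) :
    ∃ v : EuclideanSpace ℂ (Fin N), ‖v‖ = 1 ∧
      z = inner ℂ v (Matrix.toEuclideanCLM (𝕜 := ℂ) X v) := by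
  obtain ⟨y, hy, rfl⟩ := hz
  refine ⟨WithLp.toLp 2 y, ?_, ?_⟩
  · simp [EuclideanSpace.norm_eq, hy]
  · simp [PiLp.inner_apply, mul_comm]

theorem smul_mem_numericalRange {N : ℕ} {X : Matrix (Fin N) (Fin N) ℂ} {z : ℂ}
    (hz : z ∈ numericalRange X) (c : ℂ) : c * z ∈ numericalRange (c • X) := by
  obtain ⟨y, hy, rfl⟩ := hz
  refine ⟨y, hy, ?_⟩
  simp only [Matrix.smul_mulVec, Pi.smul_apply, smul_eq_mul, Finset.mul_sum]
  exact Finset.sum_congr rfl fun i _ => by ring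

theorem abs_re_le_opNorm_reMat {N : ℕ} {X : Matrix (Fin N) (Fin N) ℂ} {z : ℂ}
    (hz : z ∈ numericalRange X) : |z.re| ≤ opNorm (reMat X) := by
  obtain ⟨v, hv, rfl⟩ := exists_unit_vector_of_mem_numericalRange hz
  set A := Matrix.toEuclideanCLM (𝕜 := ℂ) X
  have hT : Matrix.toEuclideanCLM (𝕜 := ℂ) (reMat X)
      = (2 : ℂ)⁻¹ • (A + ContinuousLinearMap.adjoint A) := by
    rw [reMat, map_smul, map_add, ← Matrix.star_eq_conjTranspose, map_star,
      ContinuousLinearMap.star_eq_adjoint]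
  have hre : inner ℂ v (Matrix.toEuclideanCLM (𝕜 := ℂ) (reMat X) v)
      = (((inner ℂ v (A v)).re : ℝ) : ℂ) := by
    rw [hT, _root_.smul_apply, _root_.add_apply, inner_smul_right,
      inner_add_right, ContinuousLinearMap.adjoint_inner_right, ← inner_conj_symm (A v) v,
      Complex.add_conj]
    push_cast
    ring
  calc |(inner ℂ v (A v)).re|
      = ‖inner ℂ v (Matrix.toEuclideanCLM (𝕜 := ℂ) (reMat X) v)‖ := by
        rw [hre, Complex.norm_real, Real.norm_eq_abs]
    _ ≤ ‖v‖ * ‖Matrix.toEuclideanCLM (𝕜 := ℂ) (reMat X) v‖ := norm_inner_le_norm _ _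
    _ ≤ ‖v‖ * (‖Matrix.toEuclideanCLM (𝕜 := ℂ) (reMat X)‖ * ‖v‖) := by
        gcongr
        exact ContinuousLinearMap.le_opNorm _ _
    _ = opNorm (reMat X) := by simp [hv, opNorm]

theorem abs_re_exp_mul_le_opNorm {N : ℕ} {X : Matrix (Fin N) (Fin N) ℂ} {z : ℂ}
    (hz : z ∈ numericalRange X) (θ : ℝ) :
    |(Complex.exp ((θ : ℂ) * Complex.I) * z).re|
      ≤ opNorm (reMat (Complex.exp ((θ : ℂ) * Complex.I) • X)) :=
  abs_re_le_opNorm_reMat (smul_mem_numericalRange hz _)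

theorem exp_toIcoMod_mul_I (θ : ℝ) :
    Complex.exp (((toIcoMod Real.two_pi_pos 0 θ : ℝ) : ℂ) * Complex.I)
      = Complex.exp ((θ : ℂ) * Complex.I) := by
  rw [toIcoMod, Complex.exp_eq_exp_iff_exists_int]
  refine ⟨-toIcoDiv Real.two_pi_pos 0 θ, ?_⟩
  push_cast [zsmul_eq_mul]
  ring

theorem exists_lt_re_of_notMem_radialSet {R : ℝ → ℝ} (hR0 : ∀ θ, 0 < R θ) {z : ℂ}
    (hz : z ∉ radialSet R) :
    ∃ θ : ℝ, R θ < (Complex.exp ((θ : ℂ) * Complex.I) * z).re := by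
  have hpi : (0 : ℝ) < 2 * Real.pi := Real.two_pi_pos
  set θ := toIcoMod hpi 0 (-z.arg) with hθ
  have hmem : θ ∈ Set.Ico (0 : ℝ) (2 * Real.pi) := by
    simpa using toIcoMod_mem_Ico hpi 0 (-z.arg)
  have hrot : Complex.exp ((θ : ℂ) * Complex.I) * z = (‖z‖ : ℝ) := by
    rw [hθ, exp_toIcoMod_mul_I]
    conv_lhs => rw [← Complex.norm_mul_exp_arg_mul_I z]
    rw [mul_left_comm, ← Complex.exp_add]
    simp
  have hpolar : z = ‖z‖ * Complex.exp (-(θ : ℂ) * Complex.I) := by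
    rw [← hrot, mul_right_comm, ← Complex.exp_add]
    simp
  refine ⟨θ, ?_⟩
  rw [hrot, Complex.ofReal_re]
  by_contra! hle
  refine hz ⟨‖z‖ / R θ, ⟨div_nonneg (norm_nonneg _) (hR0 _).le,
    (div_le_one (hR0 _)).2 hle⟩, θ, hmem, ?_⟩
  have hne : ((R θ : ℝ) : ℂ) ≠ 0 := Complex.ofReal_ne_zero.2 (hR0 _).ne'
  conv_lhs => rw [hpolar]
  push_cast
  field_simp

theorem exists_rat_lt_re_of_notMem_radialSet {R : ℝ → ℝ} (hR0 : ∀ θ, 0 < R θ)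
    (hRcont : Continuous R) {z : ℂ} (hz : z ∉ radialSet R) :
    ∃ q : ℚ, R q < (Complex.exp (((q : ℝ) : ℂ) * Complex.I) * z).re := by
  have hopen : IsOpen {θ : ℝ | R θ < (Complex.exp ((θ : ℂ) * Complex.I) * z).re} :=
    isOpen_lt hRcont (by fun_prop)
  exact Rat.denseRange_cast.exists_mem_open hopen (exists_lt_re_of_notMem_radialSet hR0 hz)

theorem eventually_numericalRange_subset_cthickening {R : ℝ → ℝ} (hR0 : ∀ θ, 0 < R θ)
    (hRcont : Continuous R) {X : (N : ℕ) → Matrix (Fin N) (Fin N) ℂ}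
    (hrat : ∀ q : ℚ, Tendsto
      (fun N : ℕ => opNorm (reMat (Complex.exp (((q : ℝ) : ℂ) * Complex.I) • X N)))
        atTop (nhds (R q)))
    (hpi : Tendsto
      (fun N : ℕ => opNorm (reMat (Complex.exp (((Real.pi / 2 : ℝ) : ℂ) * Complex.I) • X N)))
        atTop (nhds (R (Real.pi / 2))))
    {ε : ℝ} (hε : 0 < ε) :
    ∀ᶠ N in atTop, numericalRange (X N) ⊆ Metric.cthickening ε (radialSet R) := by
  set M : ℝ := (R 0 + 1) + (R (Real.pi / 2) + 1)
  have hbound : ∀ᶠ N in atTop, numericalRange (X N) ⊆ Metric.closedBall 0 M := by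
    have h0 := hrat 0
    simp only [Rat.cast_zero] at h0
    filter_upwards [h0.eventually_lt_const (lt_add_one _),
      hpi.eventually_lt_const (lt_add_one _)] with N hre him z hz
    have h1 := (abs_re_exp_mul_le_opNorm hz 0).trans_lt hre
    have h2 := (abs_re_exp_mul_le_opNorm hz (Real.pi / 2)).trans_lt him
    have hI : Complex.exp (((Real.pi / 2 : ℝ) : ℂ) * Complex.I) = Complex.I := by
      push_cast
      exact Complex.exp_pi_div_two_mul_I
    rw [hI] at h2
    simp only [Complex.ofReal_zero, zero_mul, Complex.exp_zero, one_mul] at h1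
    simp only [Complex.I_mul_re, abs_neg] at h2
    rw [mem_closedBall_zero_iff]
    linarith [Complex.norm_le_abs_re_add_abs_im z]
  have hcompact : IsCompact (Metric.closedBall (0 : ℂ) M \ Metric.thickening ε (radialSet R)) :=
    (isCompact_closedBall 0 M).diff Metric.isOpen_thickening
  have hsep : ∀ᶠ N in atTop,
      ∀ z ∈ Metric.closedBall (0 : ℂ) M \ Metric.thickening ε (radialSet R),
        z ∉ numericalRange (X N) := by
    refine hcompact.induction_on (p := fun s => ∀ᶠ N in atTop, ∀ z ∈ s, z ∉ numericalRange (X N))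
      (by simp) (fun s t hst ht => ht.mono fun N hN z hz => hN z (hst hz)) ?_ fun z hz => ?_
    · intro s t hs ht
      filter_upwards [hs, ht] with N hN hN' z hz
      exact hz.elim (hN z) (hN' z)
    obtain ⟨q, hq⟩ := exists_rat_lt_re_of_notMem_radialSet hR0 hRcont
      fun hmem => hz.2 (Metric.self_subset_thickening hε _ hmem)
    obtain ⟨c, hRc, hcz⟩ := exists_between hq
    have hopen : IsOpen {w : ℂ | c < (Complex.exp (((q : ℝ) : ℂ) * Complex.I) * w).re} :=
      isOpen_lt continuous_const (by fun_prop)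
    refine ⟨_, mem_nhdsWithin_of_mem_nhds (hopen.mem_nhds hcz), ?_⟩
    filter_upwards [(hrat q).eventually_lt_const hRc] with N hN w hw hwW
    exact (hN.trans hw).not_ge ((le_abs_self _).trans (abs_re_exp_mul_le_opNorm hwW q))
  filter_upwards [hbound, hsep] with N hb hs z hz
  by_contra hnot
  exact hs z ⟨hb hz, fun hmem => hnot (Metric.thickening_subset_cthickening _ _ hmem)⟩ hz

/-- Theorem `inclusion`, qualitative part: if
`‖Re(e^{iθ} X_N)‖ → R(θ)` a.s. for each `θ ∈ [0, 2π)`, then almost surely the numerical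
range `W(X_N)` is eventually contained in any `ε`-neighborhood of `K(R)`. -/
theorem numericalRange_subset_radialSet
    {Ω : Type*} [MeasurableSpace Ω] (P : Measure Ω) [IsProbabilityMeasure P]
    (R : ℝ → ℝ) (hR1 : ∀ θ, 1 ≤ R θ) (hRcont : Continuous R)
    (hRper : Function.Periodic R (2 * Real.pi))
    (X : (N : ℕ) → Ω → Matrix (Fin N) (Fin N) ℂ)
    (h : ∀ θ ∈ Set.Ico (0 : ℝ) (2 * Real.pi), ∀ᵐ ω ∂P,
      Tendsto (fun N : ℕ => opNorm (reMat (Complex.exp ((θ : ℂ) * Complex.I) • X N ω)))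
        atTop (nhds (R θ))) :
    ∀ᵐ ω ∂P, ∀ ε : ℝ, 0 < ε → ∃ N₀ : ℕ, ∀ N ≥ N₀,
      numericalRange (X N ω) ⊆ Metric.cthickening ε (radialSet R) := by
  have hall : ∀ θ : ℝ, ∀ᵐ ω ∂P,
      Tendsto (fun N : ℕ => opNorm (reMat (Complex.exp ((θ : ℂ) * Complex.I) • X N ω)))
        atTop (nhds (R θ)) := fun θ => by
    have hθ := h (toIcoMod Real.two_pi_pos 0 θ)
      (by simpa using toIcoMod_mem_Ico Real.two_pi_pos 0 θ)
    rw [exp_toIcoMod_mul_I] at hθ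
    rwa [toIcoMod, hRper.sub_zsmul_eq] at hθ
  filter_upwards [ae_all_iff.2 fun q : ℚ => hall q, hall (Real.pi / 2)] with ω hrat hpi ε hε
  exact eventually_atTop.1 (eventually_numericalRange_subset_cthickening
    (fun θ => zero_lt_one.trans_le (hR1 θ)) hRcont hrat hpi hε)
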